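/- arXiv:0708.0670 — 2 statements merged into one kernel-verified Lean document; each statement's English description precedes it below -/
import Mathlib

section
/- Let 0 < η1 < 1, γ > 0, ε ∈ (0, γ), and C0, C1 > 0. Let (k_n)_{n≥1} be real numbers with |k_n − π/2| ≤ C0 n^{−η1} for all n ≥ 1, and let θ : ℕ → ℝ satisfy |θ(n+1) − θ(n) − k_n| ≤ C1 max(n^{−γ+ε}, n^{−1}) for all n ≥ 1. Then there exists C > 0 such that |Σ_{l=1}^{j} cos(2θ(l))| ≤ C max(j^{1−γ+ε}, j^{1−η1}) for all j ≥ 1. -/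
open Filter Real

/-- Partial sums of `l ^ (-s)` with `0 < s < 1` are bounded by the corresponding integral. -/
theorem sum_Icc_rpow_neg_le {s : ℝ} (hs : 0 < s) (hs1 : s < 1) (j : ℕ) :
    ∑ l ∈ Finset.Icc 1 j, (l : ℝ) ^ (-s) ≤ (j : ℝ) ^ (1 - s) / (1 - s) := by
  have h1s : 0 < 1 - s := by linarith
  induction j with
  | zero => simp [Real.zero_rpow h1s.ne']
  | succ j ih =>
    rw [Finset.sum_Icc_succ_top (by omega)]
    have hj : (0 : ℝ) < (j : ℝ) + 1 := by positivity
    have bernoulli : (1 + -(1 / ((j : ℝ) + 1))) ^ (1 - s) ≤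
        1 + (1 - s) * -(1 / ((j : ℝ) + 1)) := by
      refine rpow_one_add_le_one_add_mul_self ?_ h1s.le (by linarith)
      rw [neg_le_neg_iff, div_le_one hj]
      linarith [Nat.cast_nonneg (α := ℝ) j]
    have hfrac : 1 + -(1 / ((j : ℝ) + 1)) = (j : ℝ) / ((j : ℝ) + 1) := by
      field_simp
      ring
    rw [hfrac, Real.div_rpow (Nat.cast_nonneg j) hj.le,
      div_le_iff₀ (Real.rpow_pos_of_pos hj _)] at bernoulli
    have hpow : ((j : ℝ) + 1) ^ (1 - s) = ((j : ℝ) + 1) * ((j : ℝ) + 1) ^ (-s) := by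
      rw [sub_eq_add_neg, Real.rpow_add hj, Real.rpow_one]
    have hstep : (1 - s) * ((j : ℝ) + 1) ^ (-s) + (j : ℝ) ^ (1 - s) ≤
        ((j : ℝ) + 1) ^ (1 - s) := by
      have hcancel : (1 + (1 - s) * -(1 / ((j : ℝ) + 1))) * ((j : ℝ) + 1) ^ (1 - s) =
          ((j : ℝ) + 1) ^ (1 - s) - (1 - s) * ((j : ℝ) + 1) ^ (-s) := by
        rw [hpow]
        field_simp
        ring
      linarith
    rw [le_div_iff₀ h1s] at ih ⊢
    push_cast
    linarith

/-- Partial sums of `l ^ (-a)`, for an arbitrary exponent, are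
`O(max (j ^ (1 - a)) (j ^ (1 - s)))` when `0 < s < 1`. -/
theorem exists_sum_Icc_rpow_neg_le_max {a s : ℝ} (ha : 0 < a) (hs : 0 < s) (hs1 : s < 1) :
    ∃ K : ℝ, 0 < K ∧ ∀ j : ℕ, ∑ l ∈ Finset.Icc 1 j, (l : ℝ) ^ (-a) ≤
      K * max ((j : ℝ) ^ (1 - a)) ((j : ℝ) ^ (1 - s)) := by
  by_cases ha1 : a < 1
  · refine ⟨(1 - a)⁻¹, inv_pos.2 (by linarith), fun j => ?_⟩
    refine (sum_Icc_rpow_neg_le ha ha1 j).trans ?_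
    rw [div_eq_inv_mul]
    exact mul_le_mul_of_nonneg_left (le_max_left _ _) (inv_nonneg.2 (by linarith))
  · refine ⟨(1 - s)⁻¹, inv_pos.2 (by linarith), fun j => ?_⟩
    calc ∑ l ∈ Finset.Icc 1 j, (l : ℝ) ^ (-a)
        ≤ ∑ l ∈ Finset.Icc 1 j, (l : ℝ) ^ (-s) := by
          refine Finset.sum_le_sum fun l hl => ?_
          refine Real.rpow_le_rpow_of_exponent_le ?_ (by linarith)
          exact_mod_cast (Finset.mem_Icc.1 hl).1
      _ ≤ (j : ℝ) ^ (1 - s) / (1 - s) := sum_Icc_rpow_neg_le hs hs1 j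
      _ ≤ _ := by
          rw [div_eq_inv_mul]
          exact mul_le_mul_of_nonneg_left (le_max_right _ _) (inv_nonneg.2 (by linarith))

/-- The cosines of twice two angles nearly cancel when the angles differ by nearly `π / 2`. -/
theorem abs_cos_two_mul_add_cos_two_mul_le (x y : ℝ) :
    |Real.cos (2 * x) + Real.cos (2 * y)| ≤ 2 * |y - x - π / 2| := by
  have hshift : Real.cos (2 * y) = -Real.cos (2 * y - π) := by
    rw [Real.cos_sub_pi, neg_neg]
  have hlip := Real.abs_cos_sub_cos_le (2 * x) (2 * y - π)
  rw [hshift, ← sub_eq_add_neg]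
  refine hlip.trans_eq ?_
  rw [show 2 * x - (2 * y - π) = -(2 * (y - x - π / 2)) by ring, abs_neg, abs_mul, abs_two]

/-- Cosine sums of angles are controlled by the total deviation of the increments from `π / 2`. -/
theorem abs_sum_cos_two_mul_le (θ : ℕ → ℝ) (j : ℕ) :
    |∑ l ∈ Finset.Icc 1 j, Real.cos (2 * θ l)| ≤
      1 + ∑ l ∈ Finset.Icc 1 j, |θ (l + 1) - θ l - π / 2| := by
  have telescope : 2 * ∑ l ∈ Finset.Icc 1 j, Real.cos (2 * θ l) =
      ∑ l ∈ Finset.Icc 1 j, (Real.cos (2 * θ l) + Real.cos (2 * θ (l + 1))) +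
        (Real.cos (2 * θ 1) - Real.cos (2 * θ (j + 1))) := by
    induction j with
    | zero => simp
    | succ j ih =>
      rw [Finset.sum_Icc_succ_top (by omega), Finset.sum_Icc_succ_top (by omega)]
      linarith
  have hsum : |∑ l ∈ Finset.Icc 1 j, (Real.cos (2 * θ l) + Real.cos (2 * θ (l + 1)))| ≤
      2 * ∑ l ∈ Finset.Icc 1 j, |θ (l + 1) - θ l - π / 2| := by
    rw [Finset.mul_sum]
    exact (Finset.abs_sum_le_sum_abs _ _).trans
      (Finset.sum_le_sum fun l _ => abs_cos_two_mul_add_cos_two_mul_le _ _)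
  rw [abs_le] at hsum ⊢
  constructor <;>
    linarith [Real.cos_le_one (2 * θ 1), Real.neg_one_le_cos (2 * θ 1),
      Real.cos_le_one (2 * θ (j + 1)), Real.neg_one_le_cos (2 * θ (j + 1))]

/-- **Lemma (cancellation in cosine sums of Prüfer angles).**  If the quasimomenta `k_n`
are within `C0 n^{-η1}` of `π/2` and the angle increments `θ(n+1) - θ(n)` are within
`C1 max(n^{-γ+ε}, n^{-1})` of `k_n`, then the partial sums of `cos(2θ(l))` are
`O(max(j^{1-γ+ε}, j^{1-η1}))`. -/
theorem pruefer_cosine_sum_bound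
    (η1 γ ε C0 C1 : ℝ)
    (hη1 : 0 < η1) (hη1' : η1 < 1) (hγ : 0 < γ) (hε : 0 < ε) (hεγ : ε < γ)
    (hC0 : 0 < C0) (hC1 : 0 < C1)
    (k : ℕ → ℝ) (hk : ∀ n : ℕ, 1 ≤ n → |k n - π / 2| ≤ C0 * (n : ℝ) ^ (-η1))
    (θ : ℕ → ℝ)
    (hθ : ∀ n : ℕ, 1 ≤ n →
      |θ (n + 1) - θ n - k n| ≤ C1 * max ((n : ℝ) ^ (-γ + ε)) ((n : ℝ)⁻¹)) :
    ∃ C : ℝ, 0 < C ∧ ∀ j : ℕ, 1 ≤ j →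
      |∑ l ∈ Finset.Icc 1 j, Real.cos (2 * θ l)| ≤
        C * max ((j : ℝ) ^ (1 - γ + ε)) ((j : ℝ) ^ (1 - η1)) := by
  obtain ⟨K, hK, hsumK⟩ :=
    exists_sum_Icc_rpow_neg_le_max (sub_pos.2 hεγ) hη1 hη1'
  obtain ⟨L, hL, hsumL⟩ := exists_sum_Icc_rpow_neg_le_max hη1 hη1 hη1'
  refine ⟨1 + (C0 + C1) * L + C1 * K, by positivity, fun j hj => ?_⟩
  have hincr : ∀ l ∈ Finset.Icc 1 j, |θ (l + 1) - θ l - π / 2| ≤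
      (C0 + C1) * (l : ℝ) ^ (-η1) + C1 * (l : ℝ) ^ (-(γ - ε)) := by
    intro l hl
    have hl1 : 1 ≤ l := (Finset.mem_Icc.1 hl).1
    have hinv : (l : ℝ)⁻¹ ≤ (l : ℝ) ^ (-η1) := by
      rw [← Real.rpow_neg_one]
      exact Real.rpow_le_rpow_of_exponent_le (by exact_mod_cast hl1) (by linarith)
    have hmax : max ((l : ℝ) ^ (-γ + ε)) ((l : ℝ)⁻¹) ≤
        (l : ℝ) ^ (-(γ - ε)) + (l : ℝ) ^ (-η1) := by
      rw [show -γ + ε = -(γ - ε) by ring]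
      refine max_le (le_add_of_nonneg_right (by positivity)) (hinv.trans ?_)
      exact le_add_of_nonneg_left (by positivity)
    calc |θ (l + 1) - θ l - π / 2|
        = |(θ (l + 1) - θ l - k l) + (k l - π / 2)| := by ring_nf
      _ ≤ |θ (l + 1) - θ l - k l| + |k l - π / 2| := abs_add_le _ _
      _ ≤ C1 * ((l : ℝ) ^ (-(γ - ε)) + (l : ℝ) ^ (-η1)) + C0 * (l : ℝ) ^ (-η1) :=
          add_le_add ((hθ l hl1).trans (mul_le_mul_of_nonneg_left hmax hC1.le)) (hk l hl1)
      _ = _ := by ring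
  have hdev := Finset.sum_le_sum hincr
  rw [Finset.sum_add_distrib, ← Finset.mul_sum, ← Finset.mul_sum] at hdev
  rw [show 1 - γ + ε = 1 - (γ - ε) by ring]
  set M := max ((j : ℝ) ^ (1 - (γ - ε))) ((j : ℝ) ^ (1 - η1))
  have hjM : (j : ℝ) ^ (1 - η1) ≤ M := le_max_right _ _
  have hone : 1 ≤ M :=
    (Real.one_le_rpow (by exact_mod_cast hj) (by linarith)).trans hjM
  have hη := mul_le_mul_of_nonneg_left
    (((hsumL j).trans_eq (by rw [max_self])).trans (mul_le_mul_of_nonneg_left hjM hL.le))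
    (add_pos hC0 hC1).le
  have hγε := mul_le_mul_of_nonneg_left (hsumK j) hC1.le
  calc |∑ l ∈ Finset.Icc 1 j, Real.cos (2 * θ l)|
      ≤ M + ((C0 + C1) * (L * M) + C1 * (K * M)) := by
        linarith [abs_sum_cos_two_mul_le θ j]
    _ = _ := by ring
end

section
/- Let (A_n) be a sequence of invertible real 2×2 matrices with d_n := det A_n > 0, such that ‖A_n‖/√(d_n) → ∞ and d_n·‖A_{n+1} A_n^{−1}‖/(‖A_n‖·‖A_{n+1}‖) → 0 as n → ∞. Set φ_n = φ(A_n) and ρ_n = ρ(A_n). Then: (i) if (φ_n) converges in ℝ, then (ρ_n) converges in [0, +∞] (the value +∞ is allowed); (ii) if (ρ_n) converges to a finite limit ρ_∞ ∈ [0, ∞), then (φ_n) converges in ℝ; (iii) if ρ_n → +∞, then |φ_n| → π/2. -/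
open Filter Real Topology

noncomputable section

/-- The unit vector `u_φ = (cos φ, sin φ)ᵀ ∈ ℝ²` (as a point of Euclidean space). -/
def uVec (φ : ℝ) : EuclideanSpace ℝ (Fin 2) :=
  (EuclideanSpace.equiv (Fin 2) ℝ).symm ![Real.cos φ, Real.sin φ]

/-- The Euclidean norm of the vector `A u_φ ∈ ℝ²`. -/
def vecNorm (A : Matrix (Fin 2) (Fin 2) ℝ) (φ : ℝ) : ℝ :=
  ‖(EuclideanSpace.equiv (Fin 2) ℝ).symm (A.mulVec ![Real.cos φ, Real.sin φ])‖

/-- The operator norm of a real `2 × 2` matrix acting on Euclidean space `ℝ²`. -/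
def matOpNorm (M : Matrix (Fin 2) (Fin 2) ℝ) : ℝ :=
  ‖Matrix.toEuclideanCLM (𝕜 := ℝ) M‖

/-- `ρ(A) = ‖A u_0‖ / ‖A u_{π/2}‖`. -/
def rhoOf (A : Matrix (Fin 2) (Fin 2) ℝ) : ℝ := vecNorm A 0 / vecNorm A (π / 2)

theorem vecNorm_nonneg (A : Matrix (Fin 2) (Fin 2) ℝ) (ψ : ℝ) : 0 ≤ vecNorm A ψ := norm_nonneg _

theorem rhoOf_nonneg (A : Matrix (Fin 2) (Fin 2) ℝ) : 0 ≤ rhoOf A :=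
  div_nonneg (vecNorm_nonneg _ _) (vecNorm_nonneg _ _)

theorem vecNorm_sq (A : Matrix (Fin 2) (Fin 2) ℝ) (ψ : ℝ) :
    vecNorm A ψ ^ 2 =
      (A 0 0 * cos ψ + A 0 1 * sin ψ) ^ 2 + (A 1 0 * cos ψ + A 1 1 * sin ψ) ^ 2 := by
  simp [vecNorm, EuclideanSpace.norm_sq_eq, Fin.sum_univ_two]

theorem norm_mulVec_le (M : Matrix (Fin 2) (Fin 2) ℝ) (v : Fin 2 → ℝ) :
    ‖(EuclideanSpace.equiv (Fin 2) ℝ).symm (M.mulVec v)‖ ≤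
      matOpNorm M * ‖(EuclideanSpace.equiv (Fin 2) ℝ).symm v‖ :=
  (Matrix.toEuclideanCLM (𝕜 := ℝ) M).le_opNorm ((EuclideanSpace.equiv (Fin 2) ℝ).symm v)

theorem vecNorm_le_matOpNorm (A : Matrix (Fin 2) (Fin 2) ℝ) (ψ : ℝ) :
    vecNorm A ψ ≤ matOpNorm A := by
  have h : ‖(EuclideanSpace.equiv (Fin 2) ℝ).symm ![cos ψ, sin ψ]‖ = 1 := by
    simp [EuclideanSpace.norm_eq, Fin.sum_univ_two]
  simpa only [vecNorm, h, mul_one] using norm_mulVec_le A ![cos ψ, sin ψ]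

theorem vecNorm_mul_le (M A : Matrix (Fin 2) (Fin 2) ℝ) (ψ : ℝ) :
    vecNorm (M * A) ψ ≤ matOpNorm M * vecNorm A ψ := by
  simpa only [vecNorm, Matrix.mulVec_mulVec] using norm_mulVec_le M (A.mulVec ![cos ψ, sin ψ])

theorem vecNorm_pos {A : Matrix (Fin 2) (Fin 2) ℝ} (hd : 0 < A.det) (ψ : ℝ) :
    0 < vecNorm A ψ := by
  refine (vecNorm_nonneg A ψ).lt_of_ne' fun h => hd.ne' ?_
  have h2 := vecNorm_sq A ψ
  rw [h] at h2
  have e1 : A 0 0 * cos ψ + A 0 1 * sin ψ = 0 := by nlinarith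
  have e2 : A 1 0 * cos ψ + A 1 1 * sin ψ = 0 := by nlinarith
  have h3 := sin_sq_add_cos_sq ψ
  rw [Matrix.det_fin_two]
  linear_combination (-(A 0 0 * A 1 1 - A 0 1 * A 1 0)) * h3
    + (A 1 1 * cos ψ - A 1 0 * sin ψ) * e1 + (A 0 0 * sin ψ - A 0 1 * cos ψ) * e2

theorem matOpNorm_pos {A : Matrix (Fin 2) (Fin 2) ℝ} (hd : 0 < A.det) : 0 < matOpNorm A :=
  (vecNorm_pos hd 0).trans_le (vecNorm_le_matOpNorm A 0)

/-- The angular profile of `‖A u_ψ‖` around a minimizing angle `φ`. -/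
theorem vecNorm_sq_of_minimizing {A : Matrix (Fin 2) (Fin 2) ℝ} (hd : 0 < A.det) {φ : ℝ}
    (h : vecNorm A φ = A.det / matOpNorm A) (ψ : ℝ) :
    vecNorm A ψ ^ 2 = matOpNorm A ^ 2 * sin (ψ - φ) ^ 2 +
      (A.det / matOpNorm A) ^ 2 * cos (ψ - φ) ^ 2 := by
  have hN := matOpNorm_pos hd
  have hu := vecNorm_sq A φ
  have hv := vecNorm_sq A (φ + π / 2)
  have hle := pow_le_pow_left₀ (vecNorm_nonneg _ _) (vecNorm_le_matOpNorm A (φ + π / 2)) 2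
  have hψ := vecNorm_sq A ψ
  have hdet := Matrix.det_fin_two A
  have hcs := sin_sq_add_cos_sq φ
  rw [cos_add_pi_div_two, sin_add_pi_div_two] at hv
  have ec : cos ψ = cos (ψ - φ) * cos φ - sin (ψ - φ) * sin φ := by
    rw [← cos_add]; ring_nf
  have es : sin ψ = sin (ψ - φ) * cos φ + cos (ψ - φ) * sin φ := by
    rw [← sin_add]; ring_nf
  rw [ec, es] at hψ
  rw [← h]
  have hND : vecNorm A φ * matOpNorm A = A.det := by rw [h]; field_simp
  have hpos := vecNorm_pos hd φ
  generalize cos (ψ - φ) = C at *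
  generalize sin (ψ - φ) = S at *
  generalize cos φ = c at *
  generalize sin φ = s at *
  generalize vecNorm A φ = p at *
  generalize vecNorm A (φ + π / 2) = q at *
  generalize matOpNorm A = N at *
  generalize A 0 0 = x at *
  generalize A 0 1 = y at *
  generalize A 1 0 = z at *
  generalize A 1 1 = w at *
  rw [hψ]
  obtain ⟨u1, hu1⟩ : ∃ t, t = x * c + y * s := ⟨_, rfl⟩
  obtain ⟨u2, hu2⟩ : ∃ t, t = z * c + w * s := ⟨_, rfl⟩
  obtain ⟨v1, hv1⟩ : ∃ t, t = x * -s + y * c := ⟨_, rfl⟩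
  obtain ⟨v2, hv2⟩ : ∃ t, t = z * -s + w * c := ⟨_, rfl⟩
  rw [← hu1, ← hu2] at hu
  rw [← hv1, ← hv2] at hv
  have hD : u1 * v2 - u2 * v1 = p * N := by
    rw [hND, hdet, hu1, hu2, hv1, hv2]; linear_combination (x * w - y * z) * hcs
  have hlag : p ^ 2 * q ^ 2 = (p * N) ^ 2 + (u1 * v1 + u2 * v2) ^ 2 := by
    rw [← hD, hu, hv]; ring
  have hmul := mul_le_mul_of_nonneg_left hle (sq_nonneg p)
  have horth : u1 * v1 + u2 * v2 = 0 := by nlinarith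
  have hq : q ^ 2 = N ^ 2 := by
    rw [horth] at hlag
    exact mul_left_cancel₀ (pow_pos hpos 2).ne' (by linarith)
  rw [hv] at hq
  have e1 : x * (C * c - S * s) + y * (S * c + C * s) = C * u1 + S * v1 := by
    rw [hu1, hv1]; ring
  have e2 : z * (C * c - S * s) + w * (S * c + C * s) = C * u2 + S * v2 := by
    rw [hu2, hv2]; ring
  rw [e1, e2, hu, ← hq]
  linear_combination 2 * C * S * horth

theorem rhoOf_sq_of_minimizing {A : Matrix (Fin 2) (Fin 2) ℝ} (hd : 0 < A.det) {φ : ℝ}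
    (h : vecNorm A φ = A.det / matOpNorm A) :
    0 < cos φ ^ 2 + (A.det / matOpNorm A ^ 2) ^ 2 * sin φ ^ 2 ∧
    rhoOf A ^ 2 = (sin φ ^ 2 + (A.det / matOpNorm A ^ 2) ^ 2 * cos φ ^ 2) /
      (cos φ ^ 2 + (A.det / matOpNorm A ^ 2) ^ 2 * sin φ ^ 2) := by
  have hN := matOpNorm_pos hd
  have h0 := vecNorm_sq_of_minimizing hd h 0
  have h1 := vecNorm_sq_of_minimizing hd h (π / 2)
  rw [sin_pi_div_two_sub, cos_pi_div_two_sub] at h1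
  rw [zero_sub, sin_neg, cos_neg, neg_sq] at h0
  have e0 : vecNorm A 0 ^ 2 =
      matOpNorm A ^ 2 * (sin φ ^ 2 + (A.det / matOpNorm A ^ 2) ^ 2 * cos φ ^ 2) := by
    rw [h0]; field_simp
  have e1 : vecNorm A (π / 2) ^ 2 =
      matOpNorm A ^ 2 * (cos φ ^ 2 + (A.det / matOpNorm A ^ 2) ^ 2 * sin φ ^ 2) := by
    rw [h1]; field_simp
  have hN2 := pow_pos hN 2
  constructor
  · have := pow_pos (vecNorm_pos hd (π / 2)) 2
    rw [e1] at this
    exact pos_of_mul_pos_right this hN2.le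
  · rw [rhoOf, div_pow, e0, e1, mul_div_mul_left _ _ hN2.ne']

theorem abs_sin_sub_le_of_minimizing {A B : Matrix (Fin 2) (Fin 2) ℝ} (hA : 0 < A.det)
    (hB : 0 < B.det) {φ ψ : ℝ} (hφ : vecNorm A φ = A.det / matOpNorm A)
    (hψ : vecNorm B ψ = B.det / matOpNorm B) :
    |sin (φ - ψ)| ≤ A.det * matOpNorm (B * A⁻¹) / (matOpNorm A * matOpNorm B) := by
  have hNA := matOpNorm_pos hA
  have hNB := matOpNorm_pos hB
  have h1 : vecNorm B φ ≤ matOpNorm (B * A⁻¹) * (A.det / matOpNorm A) := by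
    have := vecNorm_mul_le (B * A⁻¹) A φ
    rwa [Matrix.nonsing_inv_mul_cancel_right _ _ (isUnit_iff_ne_zero.2 hA.ne'), hφ] at this
  have h2 : matOpNorm B * |sin (φ - ψ)| ≤ vecNorm B φ := by
    refine abs_le_of_sq_le_sq' ?_ (vecNorm_nonneg _ _) |>.2
    rw [vecNorm_sq_of_minimizing hB hψ, mul_pow, sq_abs]
    have : 0 ≤ (B.det / matOpNorm B) ^ 2 * cos (φ - ψ) ^ 2 := by positivity
    linarith
  have h3 := h2.trans h1
  rw [le_div_iff₀ (by positivity)]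
  rw [← mul_div_assoc, le_div_iff₀ hNA] at h3
  linarith

/-- If `|φ n|` tends to a limit in `[0, π / 2)` and consecutive angles become close modulo `π`,
then `φ` converges. -/
theorem tendsto_of_tendsto_abs_of_sin_sub {φ : ℕ → ℝ} {α : ℝ} (hα : α < π / 2)
    (habs : Tendsto (fun n => |φ n|) atTop (𝓝 α))
    (hsin : Tendsto (fun n => |sin (φ n - φ (n + 1))|) atTop (𝓝 0)) :
    ∃ l : ℝ, Tendsto φ atTop (𝓝 l) := by
  have hα0 : 0 ≤ α := ge_of_tendsto' habs fun n => abs_nonneg _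
  rcases hα0.eq_or_lt with rfl | hpos
  · exact ⟨0, (tendsto_zero_iff_abs_tendsto_zero φ).2 habs⟩
  have hsum : Tendsto (fun n => sin (|φ n| + |φ (n + 1)|)) atTop (𝓝 (sin (α + α))) :=
    (continuous_sin.tendsto _).comp (habs.add (habs.comp (tendsto_add_atTop_nat 1)))
  have hs : 0 < sin (α + α) := sin_pos_of_pos_of_lt_pi (by linarith) (by linarith)
  obtain ⟨N, hN⟩ := eventually_atTop.1 (hsin.eventually_lt hsum hs)
  have hsame : ∀ n ≥ N, (0 < φ n ∧ 0 < φ (n + 1)) ∨ (φ n < 0 ∧ φ (n + 1) < 0) := by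
    intro n hn
    have h := hN n hn
    by_contra hcon
    rcases le_total 0 (φ n) with h1 | h1 <;> rcases le_total 0 (φ (n + 1)) with h2 | h2
    · have : φ n = 0 ∨ φ (n + 1) = 0 := by grind
      rcases this with h3 | h3
      · rw [h3, abs_of_nonneg h2] at h
        simp only [zero_sub, sin_neg, abs_neg, abs_zero, zero_add] at h
        exact (le_abs_self _).not_gt h
      · rw [h3, abs_of_nonneg h1] at h
        simp only [sub_zero, abs_zero, add_zero] at h
        exact (le_abs_self _).not_gt h
    · rw [abs_of_nonneg h1, abs_of_nonpos h2, ← sub_eq_add_neg] at h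
      exact (le_abs_self _).not_gt h
    · rw [abs_of_nonpos h1, abs_of_nonneg h2, ← abs_neg, ← sin_neg, neg_sub, sub_eq_neg_add] at h
      exact (le_abs_self _).not_gt h
    · have : φ n = 0 ∨ φ (n + 1) = 0 := by grind
      rcases this with h3 | h3
      · rw [h3, abs_of_nonpos h2] at h
        simp only [zero_sub, abs_zero, zero_add] at h
        exact (le_abs_self _).not_gt h
      · rw [h3, abs_of_nonpos h1] at h
        simp only [sub_zero, abs_zero, add_zero, sin_neg] at h
        exact (neg_le_abs _).not_gt h
  rcases hsame N le_rfl with ⟨h0, -⟩ | ⟨h0, -⟩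
  · have hall : ∀ n ≥ N, 0 < φ n := fun n hn => by
      induction n, hn using Nat.le_induction with
      | base => exact h0
      | succ k hk ih => rcases hsame k hk with h | h <;> linarith [h.1, h.2]
    refine ⟨α, habs.congr' ?_⟩
    filter_upwards [eventually_ge_atTop N] with n hn using abs_of_pos (hall n hn)
  · have hall : ∀ n ≥ N, φ n < 0 := fun n hn => by
      induction n, hn using Nat.le_induction with
      | base => exact h0
      | succ k hk ih => rcases hsame k hk with h | h <;> linarith [h.1, h.2]
    refine ⟨-α, habs.neg.congr' ?_⟩
    filter_upwards [eventually_ge_atTop N] with n hn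
    rw [abs_of_neg (hall n hn), neg_neg]

theorem tendsto_ofReal_of_sq_eq {ρ ε φ : ℕ → ℝ} {l : ℝ} (hρ : ∀ n, 0 ≤ ρ n)
    (hε : Tendsto ε atTop (𝓝 0))
    (hden : ∀ n, 0 < cos (φ n) ^ 2 + ε n * sin (φ n) ^ 2)
    (heq : ∀ n, ρ n ^ 2 = (sin (φ n) ^ 2 + ε n * cos (φ n) ^ 2) /
      (cos (φ n) ^ 2 + ε n * sin (φ n) ^ 2))
    (hφ : Tendsto φ atTop (𝓝 l)) :
    ∃ L : ENNReal, Tendsto (fun n => ENNReal.ofReal (ρ n)) atTop (𝓝 L) := by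
  have hs : Tendsto (fun n => sin (φ n) ^ 2) atTop (𝓝 (sin l ^ 2)) :=
    ((continuous_sin.tendsto _).comp hφ).pow 2
  have hc : Tendsto (fun n => cos (φ n) ^ 2) atTop (𝓝 (cos l ^ 2)) :=
    ((continuous_cos.tendsto _).comp hφ).pow 2
  have hnum := hs.add (hε.mul hc)
  have hdenl := hc.add (hε.mul hs)
  rw [zero_mul, add_zero] at hnum hdenl
  have hsqrt : ∀ n, ρ n = √((sin (φ n) ^ 2 + ε n * cos (φ n) ^ 2) /
      (cos (φ n) ^ 2 + ε n * sin (φ n) ^ 2)) := fun n => by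
    rw [← heq, sqrt_sq (hρ n)]
  simp only [hsqrt]
  by_cases hl : cos l = 0
  · have hsl : sin l ^ 2 = 1 := by have := sin_sq_add_cos_sq l; rw [hl] at this; linarith
    rw [hl, zero_pow two_ne_zero] at hdenl
    rw [hsl] at hnum
    have hinv := tendsto_inv_nhdsGT_zero.comp
      (tendsto_nhdsWithin_iff.2 ⟨hdenl, Eventually.of_forall hden⟩)
    exact ⟨⊤, ENNReal.tendsto_ofReal_atTop.comp
      (tendsto_sqrt_atTop.comp (hnum.pos_mul_atTop one_pos hinv))⟩
  · exact ⟨_, (ENNReal.continuous_ofReal.tendsto _).comp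
      ((continuous_sqrt.tendsto _).comp (hnum.div hdenl (pow_ne_zero 2 hl)))⟩

theorem tendsto_abs_of_sq_eq {ρ ε φ : ℕ → ℝ} {t : ℝ}
    (hmem : ∀ n, φ n ∈ Set.Ioc (-(π / 2)) (π / 2))
    (hε : Tendsto ε atTop (𝓝 0))
    (hden : ∀ n, 0 < cos (φ n) ^ 2 + ε n * sin (φ n) ^ 2)
    (heq : ∀ n, ρ n ^ 2 = (sin (φ n) ^ 2 + ε n * cos (φ n) ^ 2) /
      (cos (φ n) ^ 2 + ε n * sin (φ n) ^ 2))
    (ht : Tendsto (fun n => (1 + ρ n ^ 2)⁻¹) atTop (𝓝 t)) :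
    Tendsto (fun n => |φ n|) atTop (𝓝 (arcsin √(1 - t))) := by
  have hlim : Tendsto (fun n => arcsin √((1 - (1 + ε n) * (1 + ρ n ^ 2)⁻¹) / (1 - ε n))) atTop
      (𝓝 (arcsin √((1 - (1 + 0) * t) / (1 - 0)))) :=
    (continuous_arcsin.tendsto _).comp ((continuous_sqrt.tendsto _).comp
      ((((hε.const_add 1).mul ht).const_sub 1).div (hε.const_sub 1) (by norm_num)))
  rw [add_zero, one_mul, sub_zero, div_one] at hlim
  refine hlim.congr' ?_
  filter_upwards [hε.eventually_lt_const one_pos] with n hn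
  have h1 : (1 - (1 + ε n) * (1 + ρ n ^ 2)⁻¹) / (1 - ε n) = sin (φ n) ^ 2 := by
    have hρ : 1 + ρ n ^ 2 ≠ 0 := by positivity
    have h2 := heq n
    rw [eq_div_iff (hden n).ne', cos_sq'] at h2
    rw [div_eq_iff (by linarith), sub_eq_iff_eq_add, ← sub_eq_iff_eq_add', eq_mul_inv_iff_mul_eq₀ hρ]
    linear_combination h2
  rw [h1, sqrt_sq_eq_abs, abs_sin_eq_sin_abs_of_abs_le_pi, arcsin_sin]
  · linarith [abs_nonneg (φ n), pi_pos]
  · exact abs_le.2 ⟨(hmem n).1.le, (hmem n).2⟩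
  · exact (abs_le.2 ⟨(hmem n).1.le, (hmem n).2⟩).trans (by linarith [pi_pos])

/-- **Lemma (Kiselev–Last–Simon Lemma 8.7, part 1).**  Under the growth and ratio
hypotheses on the matrices `A_n`: if the minimizing angles `φ_n` converge then
`ρ_n` converges in `[0, ∞]`; if `ρ_n` converges to a finite limit then `φ_n` converges;
and if `ρ_n → ∞` then `|φ_n| → π/2`. -/
theorem minimizing_angle_convergence
    (A : ℕ → Matrix (Fin 2) (Fin 2) ℝ)
    (hdet : ∀ n, 0 < (A n).det)
    (hinv : ∀ n, IsUnit (A n))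
    (hgrow : Tendsto (fun n => matOpNorm (A n) / Real.sqrt ((A n).det)) atTop atTop)
    (hratio : Tendsto
      (fun n => (A n).det * matOpNorm (A (n + 1) * (A n)⁻¹) /
        (matOpNorm (A n) * matOpNorm (A (n + 1)))) atTop (𝓝 0))
    (φ : ℕ → ℝ)
    (hφmem : ∀ n, φ n ∈ Set.Ioc (-(π / 2)) (π / 2))
    (hφmin : ∀ n, (1 / Real.sqrt ((A n).det)) * vecNorm (A n) (φ n) =
      Real.sqrt ((A n).det) * (matOpNorm (A n))⁻¹) :
    ((∃ φlim : ℝ, Tendsto φ atTop (𝓝 φlim)) →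
      ∃ l : ENNReal, Tendsto (fun n => ENNReal.ofReal (rhoOf (A n))) atTop (𝓝 l)) ∧
    ((∃ ρlim : ℝ, Tendsto (fun n => rhoOf (A n)) atTop (𝓝 ρlim)) →
      ∃ φlim : ℝ, Tendsto φ atTop (𝓝 φlim)) ∧
    (Tendsto (fun n => rhoOf (A n)) atTop atTop →
      Tendsto (fun n => |φ n|) atTop (𝓝 (π / 2))) := by
  have hmin : ∀ n, vecNorm (A n) (φ n) = (A n).det / matOpNorm (A n) := fun n => by
    have hs := sqrt_pos.2 (hdet n)
    have h := hφmin n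
    rw [one_div, inv_mul_eq_iff_eq_mul₀ hs.ne', ← mul_assoc, mul_self_sqrt (hdet n).le] at h
    rw [h, div_eq_mul_inv]
  set ε : ℕ → ℝ := fun n => ((A n).det / matOpNorm (A n) ^ 2) ^ 2 with hεdef
  have hε : Tendsto ε atTop (𝓝 0) := by
    have h := (tendsto_inv_atTop_zero.comp hgrow).pow 4
    rw [zero_pow four_ne_zero] at h
    refine h.congr fun n => ?_
    have h4 : √(A n).det ^ 4 = (A n).det ^ 2 := by
      rw [show 4 = 2 * 2 from rfl, pow_mul, sq_sqrt (hdet n).le]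
    simp only [hεdef, Function.comp_apply, inv_div, div_pow, h4]
    ring
  have hden : ∀ n, 0 < cos (φ n) ^ 2 + ε n * sin (φ n) ^ 2 :=
    fun n => (rhoOf_sq_of_minimizing (hdet n) (hmin n)).1
  have heq : ∀ n, rhoOf (A n) ^ 2 = (sin (φ n) ^ 2 + ε n * cos (φ n) ^ 2) /
      (cos (φ n) ^ 2 + ε n * sin (φ n) ^ 2) :=
    fun n => (rhoOf_sq_of_minimizing (hdet n) (hmin n)).2
  refine ⟨fun ⟨l, hl⟩ => tendsto_ofReal_of_sq_eq (fun n => rhoOf_nonneg _) hε hden heq hl,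
    fun ⟨r, hr⟩ => ?_, fun hr => ?_⟩
  · have hr0 : 0 < 1 + r ^ 2 := by positivity
    refine tendsto_of_tendsto_abs_of_sin_sub (α := arcsin √(1 - (1 + r ^ 2)⁻¹)) ?_
      (tendsto_abs_of_sq_eq hφmem hε hden heq (((hr.pow 2).const_add 1).inv₀ hr0.ne')) ?_
    · rw [arcsin_lt_pi_div_two, sqrt_lt' one_pos]
      linarith [inv_pos.2 hr0]
    · exact squeeze_zero (fun n => abs_nonneg _)
        (fun n => abs_sin_sub_le_of_minimizing (hdet n) (hdet (n + 1)) (hmin n) (hmin (n + 1)))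
        hratio
  · have h := tendsto_abs_of_sq_eq hφmem hε hden heq (tendsto_inv_atTop_zero.comp
      (tendsto_atTop_add_const_left _ 1 ((tendsto_pow_atTop two_ne_zero).comp hr)))
    rwa [sub_zero, sqrt_one, arcsin_one] at h
end
end
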